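/- arXiv:2309.11713 — 2 statements merged into one kernel-verified Lean document; each statement's English description precedes it below -/
import Mathlib

section
/- Let d ≥ 1, p ≥ 1 a real number, and let λ be a Borel probability measure on ℝ^d with finite p-th moment. Then for all θ, θ' ∈ ℝ^d, W_p(θ♯λ, θ'♯λ) ≤ (∫ ‖x‖^p dλ(x))^{1/p} · ‖θ − θ'‖₂. -/
open MeasureTheory ENNReal Filter
open scoped RealInnerProductSpace NNReal

/-- A coupling of `μ` and `ν`: a probability measure on the product space whose
first marginal is `μ` and second marginal is `ν`. -/
def IsCoupling {X Y : Type*} [MeasurableSpace X] [MeasurableSpace Y]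
    (π : Measure (X × Y)) (μ : Measure X) (ν : Measure Y) : Prop :=
  IsProbabilityMeasure π ∧ π.map Prod.fst = μ ∧ π.map Prod.snd = ν

/-- `W_p^p(μ, ν)`: the infimum over couplings of `μ` and `ν` of the `p`-th power
transport cost `∫ ‖x - y‖^p dπ(x, y)`. -/
noncomputable def WppENN {X : Type*} [NormedAddCommGroup X] [MeasurableSpace X]
    (p : ℝ) (μ ν : Measure X) : ℝ≥0∞ :=
  ⨅ π ∈ {π : Measure (X × X) | IsCoupling π μ ν},
    ∫⁻ q, (‖q.1 - q.2‖₊ : ℝ≥0∞) ^ p ∂π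

/-- The Wasserstein distance of order `p`, `W_p(μ, ν)`, valued in `ℝ≥0∞`. -/
noncomputable def WassENN {X : Type*} [NormedAddCommGroup X] [MeasurableSpace X]
    (p : ℝ) (μ ν : Measure X) : ℝ≥0∞ := (WppENN p μ ν) ^ (1 / p)

/-- The Wasserstein distance of order `p`, `W_p(μ, ν)`, real-valued. -/
noncomputable def Wass {X : Type*} [NormedAddCommGroup X] [MeasurableSpace X]
    (p : ℝ) (μ ν : Measure X) : ℝ := (WassENN p μ ν).toReal

/-- The uniform probability distribution `σ` on the unit sphere `S^{d-1} ⊆ ℝ^d`: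
the `(d-1)`-dimensional Hausdorff measure restricted to the sphere, normalized
to total mass 1. -/
noncomputable def sphereUniform (d : ℕ) : Measure (EuclideanSpace ℝ (Fin d)) :=
  ((μH[(d : ℝ) - 1] : Measure (EuclideanSpace ℝ (Fin d)))
      (Metric.sphere (0 : EuclideanSpace ℝ (Fin d)) 1))⁻¹ •
    (μH[(d : ℝ) - 1] : Measure (EuclideanSpace ℝ (Fin d))).restrict
      (Metric.sphere (0 : EuclideanSpace ℝ (Fin d)) 1)

/-- Pushing `μ` forward under `x ↦ (f x, g x)` gives a coupling of its images under `f` and `g`. -/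
theorem isCoupling_map_prodMk {Ω X Y : Type*} [MeasurableSpace Ω] [MeasurableSpace X]
    [MeasurableSpace Y] {μ : Measure Ω} [IsProbabilityMeasure μ] {f : Ω → X} {g : Ω → Y}
    (hf : Measurable f) (hg : Measurable g) :
    IsCoupling (μ.map fun x => (f x, g x)) (μ.map f) (μ.map g) :=
  ⟨Measure.isProbabilityMeasure_map (hf.prodMk hg).aemeasurable,
    Measure.map_map measurable_fst (hf.prodMk hg),
    Measure.map_map measurable_snd (hf.prodMk hg)⟩

/-- The transport cost between two images of `μ` is at most the cost of the common coupling. -/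
theorem WppENN_map_le {Ω X : Type*} [MeasurableSpace Ω] [NormedAddCommGroup X]
    [MeasurableSpace X] (p : ℝ) {μ : Measure Ω} [IsProbabilityMeasure μ]
    {f g : Ω → X} (hf : Measurable f) (hg : Measurable g) :
    WppENN p (μ.map f) (μ.map g) ≤ ∫⁻ x, (‖f x - g x‖₊ : ℝ≥0∞) ^ p ∂μ := by
  have hπ : (μ.map fun x => (f x, g x)) ∈ {π | IsCoupling π (μ.map f) (μ.map g)} :=
    isCoupling_map_prodMk hf hg
  exact (biInf_le _ hπ).trans (lintegral_map_le _ _)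

/-- `W_p(θ♯λ, θ'♯λ) ≤ (∫ ‖x‖^p dλ)^{1/p} ⬝ ‖θ − θ'‖`. -/
theorem wasserstein_proj_lipschitz
    (d : ℕ) (hd : 1 ≤ d) (p : ℝ) (hp : 1 ≤ p)
    (lam : Measure (EuclideanSpace ℝ (Fin d))) [IsProbabilityMeasure lam]
    (hlam : ∫⁻ x, (‖x‖₊ : ℝ≥0∞) ^ p ∂lam ≠ ⊤)
    (θ θ' : EuclideanSpace ℝ (Fin d)) :
    WassENN p (lam.map fun x => ⟪θ, x⟫) (lam.map fun x => ⟪θ', x⟫)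
      ≤ (∫⁻ x, (‖x‖₊ : ℝ≥0∞) ^ p ∂lam) ^ (1 / p) * (‖θ - θ'‖₊ : ℝ≥0∞) := by
  have hp0 : 0 < p := by linarith
  have hmeas (η : EuclideanSpace ℝ (Fin d)) : Measurable fun x => ⟪η, x⟫ := by fun_prop
  have hpt (x : EuclideanSpace ℝ (Fin d)) :
      (‖⟪θ, x⟫ - ⟪θ', x⟫‖₊ : ℝ≥0∞) ^ p ≤ (‖x‖₊ : ℝ≥0∞) ^ p * (‖θ - θ'‖₊ : ℝ≥0∞) ^ p := by
    rw [← ENNReal.mul_rpow_of_nonneg _ _ hp0.le, ← inner_sub_left, mul_comm]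
    gcongr
    exact_mod_cast nnnorm_inner_le_nnnorm (𝕜 := ℝ) (θ - θ') x
  have hcost : WppENN p (lam.map fun x => ⟪θ, x⟫) (lam.map fun x => ⟪θ', x⟫)
      ≤ (∫⁻ x, (‖x‖₊ : ℝ≥0∞) ^ p ∂lam) * (‖θ - θ'‖₊ : ℝ≥0∞) ^ p := by
    rw [← lintegral_mul_const _ (by fun_prop)]
    exact (WppENN_map_le p (hmeas θ) (hmeas θ')).trans (lintegral_mono hpt)
  calc WassENN p (lam.map fun x => ⟪θ, x⟫) (lam.map fun x => ⟪θ', x⟫)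
      ≤ ((∫⁻ x, (‖x‖₊ : ℝ≥0∞) ^ p ∂lam) * (‖θ - θ'‖₊ : ℝ≥0∞) ^ p) ^ (1 / p) := by
        unfold WassENN
        gcongr
    _ = (∫⁻ x, (‖x‖₊ : ℝ≥0∞) ^ p ∂lam) ^ (1 / p) * (‖θ - θ'‖₊ : ℝ≥0∞) := by
        rw [ENNReal.mul_rpow_of_nonneg _ _ (by positivity), one_div,
          ENNReal.rpow_rpow_inv hp0.ne']
end

section
/- Let d ≥ 1, p ≥ 1 a real number, and let μ, ν be Borel probability measures on ℝ^d with finite p-th moments. Then the map θ ↦ W_p(θ♯μ, θ♯ν) is continuous on ℝ^d (in particular, continuous on the unit sphere S^{d−1}). -/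
open MeasureTheory ENNReal Filter
open scoped RealInnerProductSpace NNReal

open ProbabilityTheory

/-- The image under `f × id` of a composition product whose kernel factors through `f`. -/
lemma map_compProd_comap {X Y Z : Type*} [MeasurableSpace X] [MeasurableSpace Y]
    [MeasurableSpace Z] (μ : Measure X) [SFinite μ] (κ : Kernel Y Z) [IsSFiniteKernel κ]
    {f : X → Y} (hf : Measurable f) :
    (μ ⊗ₘ κ.comap f hf).map (Prod.map f id) = μ.map f ⊗ₘ κ := by
  ext s hs
  have hm : Measurable (Prod.map f id : X × Z → Y × Z) := hf.prodMap measurable_id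
  rw [Measure.map_apply hm hs, Measure.compProd_apply (hm hs), Measure.compProd_apply hs,
    lintegral_map (Kernel.measurable_kernel_prodMk_left hs) hf]
  rfl

/-- A coupling of `f♯μ` and `ν` lifts to a coupling of `μ` and `ν`. -/
lemma IsCoupling.exists_lift_left {X Y Z : Type*} [MeasurableSpace X] [MeasurableSpace Y]
    [MeasurableSpace Z] [StandardBorelSpace Z] [Nonempty Z] {μ : Measure X}
    [IsProbabilityMeasure μ] {ν : Measure Z} {f : X → Y} (hf : Measurable f)
    {π : Measure (Y × Z)} (h : IsCoupling π (μ.map f) ν) :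
    ∃ ρ : Measure (X × Z), IsCoupling ρ μ ν ∧ ρ.map (Prod.map f id) = π := by
  obtain ⟨hπ, h1, h2⟩ := h
  have hmap : (μ ⊗ₘ π.condKernel.comap f hf).map (Prod.map f id) = π := by
    rw [map_compProd_comap, ← h1]
    exact π.disintegrate π.condKernel
  refine ⟨μ ⊗ₘ π.condKernel.comap f hf, ⟨inferInstance, Measure.fst_compProd _ _, ?_⟩, hmap⟩
  rw [← h2]
  conv_rhs => rw [← hmap]
  rw [Measure.map_map measurable_snd (hf.prodMap measurable_id)]
  rfl

lemma IsCoupling.swap {X Y : Type*} [MeasurableSpace X] [MeasurableSpace Y] {μ : Measure X}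
    {ν : Measure Y} {π : Measure (X × Y)} (h : IsCoupling π μ ν) :
    IsCoupling (π.map Prod.swap) ν μ := by
  obtain ⟨hπ, h1, h2⟩ := h
  refine ⟨Measure.isProbabilityMeasure_map measurable_swap.aemeasurable, ?_, ?_⟩
  · rw [Measure.map_map measurable_fst measurable_swap, ← h2]
    rfl
  · rw [Measure.map_map measurable_snd measurable_swap, ← h1]
    rfl

lemma IsCoupling.map {X Y X' Y' : Type*} [MeasurableSpace X] [MeasurableSpace Y]
    [MeasurableSpace X'] [MeasurableSpace Y'] {μ : Measure X} {ν : Measure Y}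
    {π : Measure (X × Y)} (h : IsCoupling π μ ν) {f : X → X'} {g : Y → Y'}
    (hf : Measurable f) (hg : Measurable g) :
    IsCoupling (π.map (Prod.map f g)) (μ.map f) (ν.map g) := by
  obtain ⟨hπ, h1, h2⟩ := h
  refine ⟨Measure.isProbabilityMeasure_map (hf.prodMap hg).aemeasurable, ?_, ?_⟩
  · rw [Measure.map_map measurable_fst (hf.prodMap hg), ← h1, Measure.map_map hf measurable_fst]
    rfl
  · rw [Measure.map_map measurable_snd (hf.prodMap hg), ← h2, Measure.map_map hg measurable_snd]
    rfl

/-- A coupling of `f♯μ` and `g♯ν` lifts to a coupling of `μ` and `ν`. -/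
lemma IsCoupling.exists_lift {X Y X' Y' : Type*} [MeasurableSpace X] [MeasurableSpace Y]
    [MeasurableSpace X'] [MeasurableSpace Y'] [StandardBorelSpace X] [Nonempty X]
    [StandardBorelSpace Y'] [Nonempty Y'] {μ : Measure X} {ν : Measure Y}
    [IsProbabilityMeasure μ] [IsProbabilityMeasure ν] {f : X → X'} {g : Y → Y'}
    (hf : Measurable f) (hg : Measurable g) {π : Measure (X' × Y')}
    (h : IsCoupling π (μ.map f) (ν.map g)) :
    ∃ ρ : Measure (X × Y), IsCoupling ρ μ ν ∧ ρ.map (Prod.map f g) = π := by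
  obtain ⟨ρ₁, hρ₁, rfl⟩ := h.exists_lift_left hf
  obtain ⟨ρ₂, hρ₂, h₂⟩ := hρ₁.swap.exists_lift_left hg
  refine ⟨ρ₂.map Prod.swap, hρ₂.swap, ?_⟩
  have h₁ : ρ₁ = (ρ₂.map (Prod.map g id)).map Prod.swap := by
    rw [h₂, Measure.map_map measurable_swap measurable_swap, Prod.swap_swap_eq, Measure.map_id]
  rw [h₁, Measure.map_map measurable_swap (hg.prodMap measurable_id),
    Measure.map_map (hf.prodMap hg) measurable_swap,
    Measure.map_map (hf.prodMap measurable_id)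
      (measurable_swap.comp (hg.prodMap measurable_id))]
  rfl

/-- Bounding the Wasserstein distance by the cost of a coupling. -/
lemma WassENN_le {X : Type*} [NormedAddCommGroup X] [MeasurableSpace X] {p : ℝ} (hp : 0 ≤ p)
    {μ ν : Measure X} {π : Measure (X × X)} (h : IsCoupling π μ ν) :
    WassENN p μ ν ≤ (∫⁻ q, ‖q.1 - q.2‖ₑ ^ p ∂π) ^ (1 / p) :=
  ENNReal.rpow_le_rpow (iInf₂_le π h) (by positivity)

lemma le_WassENN {X : Type*} [NormedAddCommGroup X] [MeasurableSpace X] {p : ℝ} (hp : 0 < p)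
    {μ ν : Measure X} {a : ℝ≥0∞}
    (h : ∀ π, IsCoupling π μ ν → a ≤ (∫⁻ q, ‖q.1 - q.2‖ₑ ^ p ∂π) ^ (1 / p)) :
    a ≤ WassENN p μ ν := by
  rw [WassENN, one_div, ENNReal.le_rpow_inv_iff hp]
  refine le_iInf₂ fun π hπ => ?_
  have := h π hπ
  rwa [one_div, ENNReal.le_rpow_inv_iff hp] at this

section Projection

variable {E : Type*} [NormedAddCommGroup E] [InnerProductSpace ℝ E] [MeasurableSpace E]
  [BorelSpace E] [SecondCountableTopology E]

lemma lintegral_enorm_inner_sub_map (p : ℝ) (ρ : Measure (E × E)) (θ : E) :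
    ∫⁻ q, ‖q.1 - q.2‖ₑ ^ p ∂(ρ.map (Prod.map (fun x => ⟪θ, x⟫) fun x => ⟪θ, x⟫)) =
      ∫⁻ q, ‖⟪θ, q.1 - q.2⟫‖ₑ ^ p ∂ρ := by
  rw [lintegral_map (by fun_prop) (by fun_prop)]
  simp [inner_sub_right]

/-- The projected `L^p` cost of a coupling changes by at most `‖θ - θ'‖` times the sum of the
`L^p` norms of the marginals. -/
lemma IsCoupling.projected_cost_le {p : ℝ} (hp : 1 ≤ p) {μ ν : Measure E} {ρ : Measure (E × E)}
    (h : IsCoupling ρ μ ν) (θ θ' : E) :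
    (∫⁻ q, ‖⟪θ, q.1 - q.2⟫‖ₑ ^ p ∂ρ) ^ (1 / p) ≤
      (∫⁻ q, ‖⟪θ', q.1 - q.2⟫‖ₑ ^ p ∂ρ) ^ (1 / p) +
        ‖θ - θ'‖ₑ * ((∫⁻ x, ‖x‖ₑ ^ p ∂μ) ^ (1 / p) + (∫⁻ x, ‖x‖ₑ ^ p ∂ν) ^ (1 / p)) := by
  have hp0 : 0 < p := by linarith
  obtain ⟨-, h1, h2⟩ := h
  have hpt : ∀ q : E × E, ‖⟪θ, q.1 - q.2⟫‖ₑ ≤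
      ‖⟪θ', q.1 - q.2⟫‖ₑ + ‖θ - θ'‖ₑ * (‖q.1‖ₑ + ‖q.2‖ₑ) := fun q => by
    have hsplit : ⟪θ, q.1 - q.2⟫ = ⟪θ', q.1 - q.2⟫ + ⟪θ - θ', q.1 - q.2⟫ := by
      rw [← inner_add_left, add_sub_cancel]
    rw [hsplit]
    refine (enorm_add_le _ _).trans (add_le_add_right ?_ _)
    refine le_trans ?_ (mul_le_mul_right (enorm_sub_le (a := q.1) (b := q.2)) _)
    have := nnnorm_inner_le_nnnorm (𝕜 := ℝ) (θ - θ') (q.1 - q.2)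
    simp only [enorm_eq_nnnorm]
    exact_mod_cast this
  calc (∫⁻ q, ‖⟪θ, q.1 - q.2⟫‖ₑ ^ p ∂ρ) ^ (1 / p)
    _ ≤ (∫⁻ q, (‖⟪θ', q.1 - q.2⟫‖ₑ + ‖θ - θ'‖ₑ * (‖q.1‖ₑ + ‖q.2‖ₑ)) ^ p ∂ρ) ^ (1 / p) := by
      gcongr with q
      exact hpt q
    _ ≤ (∫⁻ q, ‖⟪θ', q.1 - q.2⟫‖ₑ ^ p ∂ρ) ^ (1 / p) +
        (∫⁻ q, (‖θ - θ'‖ₑ * (‖q.1‖ₑ + ‖q.2‖ₑ)) ^ p ∂ρ) ^ (1 / p) :=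
      ENNReal.lintegral_Lp_add_le (by fun_prop) (by fun_prop) hp
    _ = (∫⁻ q, ‖⟪θ', q.1 - q.2⟫‖ₑ ^ p ∂ρ) ^ (1 / p) +
        ‖θ - θ'‖ₑ * (∫⁻ q, (‖q.1‖ₑ + ‖q.2‖ₑ) ^ p ∂ρ) ^ (1 / p) := by
      simp_rw [ENNReal.mul_rpow_of_nonneg _ _ hp0.le]
      rw [lintegral_const_mul _ (by fun_prop), ENNReal.mul_rpow_of_nonneg _ _ (by positivity),
        ← ENNReal.rpow_mul, mul_one_div_cancel hp0.ne', ENNReal.rpow_one]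
    _ ≤ _ := by
      gcongr
      rw [← h1, ← h2, lintegral_map (by fun_prop) measurable_fst,
        lintegral_map (by fun_prop) measurable_snd]
      exact ENNReal.lintegral_Lp_add_le (by fun_prop) (by fun_prop) hp

variable {μ ν : Measure E} {p : ℝ}

lemma WassENN_map_inner_le (hp : 0 ≤ p) {ρ : Measure (E × E)} (h : IsCoupling ρ μ ν) (θ : E) :
    WassENN p (μ.map fun x => ⟪θ, x⟫) (ν.map fun x => ⟪θ, x⟫) ≤
      (∫⁻ q, ‖⟪θ, q.1 - q.2⟫‖ₑ ^ p ∂ρ) ^ (1 / p) := by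
  rw [← lintegral_enorm_inner_sub_map]
  exact WassENN_le hp (h.map (by fun_prop) (by fun_prop))

lemma WassENN_map_inner_le_add [CompleteSpace E] [IsProbabilityMeasure μ] [IsProbabilityMeasure ν]
    (hp : 1 ≤ p) (θ θ' : E) :
    WassENN p (μ.map fun x => ⟪θ, x⟫) (ν.map fun x => ⟪θ, x⟫) ≤
      WassENN p (μ.map fun x => ⟪θ', x⟫) (ν.map fun x => ⟪θ', x⟫) +
        ‖θ - θ'‖ₑ * ((∫⁻ x, ‖x‖ₑ ^ p ∂μ) ^ (1 / p) + (∫⁻ x, ‖x‖ₑ ^ p ∂ν) ^ (1 / p)) := by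
  have hp0 : 0 < p := by linarith
  rw [← tsub_le_iff_right]
  refine le_WassENN hp0 fun π hπ => ?_
  obtain ⟨ρ, hρ, rfl⟩ := hπ.exists_lift (by fun_prop) (by fun_prop)
  rw [tsub_le_iff_right, lintegral_enorm_inner_sub_map]
  exact (WassENN_map_inner_le hp0.le hρ θ).trans (hρ.projected_cost_le hp θ θ')

lemma isCoupling_prod {X Y : Type*} [MeasurableSpace X] [MeasurableSpace Y] (μ : Measure X)
    (ν : Measure Y) [IsProbabilityMeasure μ] [IsProbabilityMeasure ν] :
    IsCoupling (μ.prod ν) μ ν :=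
  ⟨inferInstance, by simp, by simp⟩

lemma WassENN_map_inner_ne_top [IsProbabilityMeasure μ] [IsProbabilityMeasure ν] (hp : 1 ≤ p)
    (hμ : ∫⁻ x, ‖x‖ₑ ^ p ∂μ ≠ ⊤) (hν : ∫⁻ x, ‖x‖ₑ ^ p ∂ν ≠ ⊤) (θ : E) :
    WassENN p (μ.map fun x => ⟪θ, x⟫) (ν.map fun x => ⟪θ, x⟫) ≠ ⊤ := by
  have hp0 : 0 < p := by linarith
  refine ne_top_of_le_ne_top ?_ ((WassENN_map_inner_le hp0.le (isCoupling_prod μ ν) θ).trans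
    ((isCoupling_prod μ ν).projected_cost_le hp θ 0))
  have hpi : 0 ≤ 1 / p := by positivity
  simp only [inner_zero_left, enorm_zero, ENNReal.zero_rpow_of_pos hp0, lintegral_zero,
    ENNReal.zero_rpow_of_pos (one_div_pos.2 hp0), zero_add]
  exact ENNReal.mul_ne_top enorm_ne_top (ENNReal.add_ne_top.2
    ⟨ENNReal.rpow_ne_top_of_nonneg hpi hμ, ENNReal.rpow_ne_top_of_nonneg hpi hν⟩)

/-- The projected Wasserstein distance is Lipschitz in the direction. -/
lemma lipschitzWith_Wass_map_inner [CompleteSpace E] [IsProbabilityMeasure μ]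
    [IsProbabilityMeasure ν] (hp : 1 ≤ p)
    (hμ : ∫⁻ x, ‖x‖ₑ ^ p ∂μ ≠ ⊤) (hν : ∫⁻ x, ‖x‖ₑ ^ p ∂ν ≠ ⊤) :
    LipschitzWith ((∫⁻ x, ‖x‖ₑ ^ p ∂μ) ^ (1 / p) + (∫⁻ x, ‖x‖ₑ ^ p ∂ν) ^ (1 / p)).toNNReal
      fun θ : E => Wass p (μ.map fun x => ⟪θ, x⟫) (ν.map fun x => ⟪θ, x⟫) := by
  have hpi : 0 ≤ 1 / p := by positivity
  have hC : (∫⁻ x, ‖x‖ₑ ^ p ∂μ) ^ (1 / p) + (∫⁻ x, ‖x‖ₑ ^ p ∂ν) ^ (1 / p) ≠ ⊤ :=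
    ENNReal.add_ne_top.2
      ⟨ENNReal.rpow_ne_top_of_nonneg hpi hμ, ENNReal.rpow_ne_top_of_nonneg hpi hν⟩
  refine LipschitzWith.of_le_add_mul _ fun θ θ' => ?_
  have hfin := WassENN_map_inner_ne_top hp hμ hν θ'
  have hmul := ENNReal.mul_ne_top (enorm_ne_top (x := θ - θ')) hC
  have hle := ENNReal.toReal_mono (ENNReal.add_ne_top.2 ⟨hfin, hmul⟩)
    (WassENN_map_inner_le_add (μ := μ) (ν := ν) hp θ θ')
  rw [ENNReal.toReal_add hfin hmul, ENNReal.toReal_mul, toReal_enorm, ← dist_eq_norm,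
    mul_comm (dist θ θ')] at hle
  exact hle

end Projection

/-- the map `θ ↦ W_p(θ♯μ, θ♯ν)` is continuous on `ℝ^d`. -/
theorem continuous_wasserstein_proj
    (d : ℕ) (hd : 1 ≤ d) (p : ℝ) (hp : 1 ≤ p)
    (μ ν : Measure (EuclideanSpace ℝ (Fin d)))
    [IsProbabilityMeasure μ] [IsProbabilityMeasure ν]
    (hμ : ∫⁻ x, (‖x‖₊ : ℝ≥0∞) ^ p ∂μ ≠ ⊤)
    (hν : ∫⁻ x, (‖x‖₊ : ℝ≥0∞) ^ p ∂ν ≠ ⊤) :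
    Continuous fun θ : EuclideanSpace ℝ (Fin d) =>
      Wass p (μ.map fun x => ⟪θ, x⟫) (ν.map fun x => ⟪θ, x⟫) := by
  exact (lipschitzWith_Wass_map_inner hp hμ hν).continuous
end
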